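/- Let m be odd and μ ∈ GF(2^m)\{0}. Let H'_μ = {x ∈ GF(2^m) : Tr^m(μ^{−1}·x) = 0}, and for (i,j) ∈ {0,1}² let A_{(i,j)} = |{x ∈ H'_μ : Tr^m(x·(x+μ)^{2^m−2}) = i and Tr^m((x+μ)·x^{2^m−2}) = j}|. Then A_{(0,0)} = 2^{m−3} + K(1)/8 + 1/2, A_{(0,1)} = 2^{m−3} + K(1)/8 − 1/2, A_{(1,0)} = 2^{m−3} − 3·K(1)/8 + 1/2, and A_{(1,1)} = 2^{m−3} + K(1)/8 − 1/2, where K(1) is the Kloosterman sum at 1 and the equalities hold as rational numbers. -/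

import Mathlib

open Finset
noncomputable section
open scoped Classical

/-- `GF n` is the finite field with `2^n` elements. -/
abbrev GF (n : ℕ) : Type := GaloisField 2 n

noncomputable instance (n : ℕ) : Fintype (GF n) := Fintype.ofFinite _

/-- The absolute trace map `GF n → 𝔽₂`. -/
def tr {n : ℕ} (x : GF n) : ZMod 2 := Algebra.trace (ZMod 2) (GF n) x

/-- `A_{(i,j)}`: the number of `x ∈ H'_μ = {x : Tr(μ⁻¹·x) = 0}` with
`Tr(x/(x+μ)) = i` and `Tr((x+μ)/x) = j`.  (Here `z⁻¹ = z^(2^m-2)`, with `0⁻¹ = 0`.) -/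
def Acnt {m : ℕ} (mu : GF m) (i j : ZMod 2) : ℕ :=
  (univ.filter (fun x : GF m =>
    tr (mu⁻¹ * x) = 0 ∧ tr (x * (x + mu)⁻¹) = i ∧ tr ((x + mu) * x⁻¹) = j)).card

section Trace

variable {n : ℕ}

theorem tr_add (x y : GF n) : tr (x + y) = tr x + tr y :=
  map_add (Algebra.trace (ZMod 2) (GF n)) x y

theorem tr_sq (x : GF n) : tr (x ^ 2) = tr x := by
  have h := Algebra.trace_eq_of_algEquiv
    (FiniteField.frobeniusAlgEquivOfAlgebraic (ZMod 2) (GF n)) x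
  simpa [tr] using h

theorem tr_one (hn : Odd n) : tr (1 : GF n) = 1 := by
  have h := Algebra.trace_algebraMap (S := GF n) (1 : ZMod 2)
  rw [map_one, GaloisField.finrank 2 hn.pos.ne', nsmul_one] at h
  exact h.trans ((ZMod.natCast_eq_one_iff_odd).2 hn)

/-- The canonical additive character of `GF n`, with values in `ℚ`. -/
def chi (x : GF n) : ℚ := (-1) ^ (tr x).val

theorem zmod_two_eq_zero_or_one (a : ZMod 2) : a = 0 ∨ a = 1 := by
  revert a
  decide

theorem neg_one_pow_val_add (a b : ZMod 2) :
    (-1 : ℚ) ^ (a + b).val = (-1) ^ a.val * (-1) ^ b.val := by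
  rcases zmod_two_eq_zero_or_one a with rfl | rfl <;>
    rcases zmod_two_eq_zero_or_one b with rfl | rfl <;>
    simp [ZMod.val_one, CharTwo.add_self_eq_zero]

theorem chi_add (x y : GF n) : chi (x + y) = chi x * chi y := by
  simp only [chi, tr_add, neg_one_pow_val_add]

theorem chi_zero : chi (0 : GF n) = 1 := by
  simp [chi, tr]

theorem chi_one (hn : Odd n) : chi (1 : GF n) = -1 := by
  simp [chi, tr_one hn, ZMod.val_one]

theorem chi_add_one (hn : Odd n) (x : GF n) : chi (x + 1) = -chi x := by
  rw [chi_add, chi_one hn, mul_neg_one]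

theorem sum_shift (f : GF n → ℚ) : ∑ x, f (x + 1) = ∑ x, f x :=
  Equiv.sum_comp (Equiv.addRight (1 : GF n)) f

theorem sum_chi (hn : Odd n) : ∑ x : GF n, chi x = 0 := by
  have h := sum_shift (chi (n := n))
  simp only [chi_add_one hn, sum_neg_distrib] at h
  linarith

theorem sum_chi_inv (hn : Odd n) : ∑ x : GF n, chi x⁻¹ = 0 :=
  (Equiv.sum_comp (Equiv.inv (GF n)) chi).trans (sum_chi hn)

theorem sum_chi_mul_sq_add (hn : Odd n) (g : GF n → ℚ) :
    ∑ y : GF n, chi y * g (y ^ 2 + y) = 0 := by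
  have h := sum_shift fun y : GF n => chi y * g (y ^ 2 + y)
  have e : ∀ y : GF n, (y + 1) ^ 2 + (y + 1) = y ^ 2 + y := fun y => by
    linear_combination (y + 1) * CharTwo.two_eq_zero (R := GF n)
  simp only [chi_add_one hn, e, neg_mul, sum_neg_distrib] at h
  linarith

theorem image_sq_add_ker_tr (hn : Odd n) :
    (univ.filter fun y : GF n => tr y = 0).image (fun y => y ^ 2 + y) =
      univ.filter fun y : GF n => tr y = 0 := by
  refine eq_of_subset_of_card_le ?_ ?_
  · intro z hz
    obtain ⟨y, -, rfl⟩ := mem_image.1 hz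
    simp [tr_add, tr_sq, CharTwo.add_self_eq_zero]
  · rw [card_image_of_injOn]
    intro x hx y hy hxy
    have hx : tr x = 0 := by simpa using hx
    have hy : tr y = 0 := by simpa using hy
    have hxy : x ^ 2 + x = y ^ 2 + y := hxy
    have h : (x + y) * (x + y + 1) = 0 := by
      linear_combination hxy + (x * y + y ^ 2 + y) * CharTwo.two_eq_zero (R := GF n)
    rcases mul_eq_zero.1 h with h | h
    · exact CharTwo.add_eq_zero.1 h
    · have := congrArg tr h
      rw [tr_add, tr_add, hx, hy, tr_one hn] at this
      simp [tr] at this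

theorem one_add_chi (x : GF n) : 1 + chi x = if tr x = 0 then 2 else 0 := by
  unfold chi
  generalize tr x = a
  rcases zmod_two_eq_zero_or_one a with rfl | rfl <;> norm_num [ZMod.val_one]

theorem sum_sq_add (hn : Odd n) (g : GF n → ℚ) :
    ∑ y : GF n, g (y ^ 2 + y) = ∑ y : GF n, (1 + chi y) * g y := by
  have key : ∑ y : GF n, (1 + chi y) * g (y ^ 2 + y) = ∑ y : GF n, (1 + chi y) * g y := by
    have h : ∀ f : GF n → ℚ, ∑ y : GF n, (1 + chi y) * f y =
        ∑ y ∈ univ.filter (fun y : GF n => tr y = 0), 2 * f y := fun f => by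
      simp only [one_add_chi, sum_filter, ite_mul, zero_mul]
    rw [h fun y => g (y ^ 2 + y), h g]
    conv_rhs => rw [← image_sq_add_ker_tr hn]
    rw [sum_image]
    exact card_image_iff.1 (by rw [image_sq_add_ker_tr hn])
  rw [← key]
  simp only [add_mul, one_mul, sum_add_distrib, sum_chi_mul_sq_add hn, add_zero]

theorem chi_div_add_one (hn : Odd n) (y : GF n) :
    chi (y * (y + 1)⁻¹) = -chi (y + 1)⁻¹ + if y = 1 then 2 else 0 := by
  split_ifs with h
  · subst h
    simp [CharTwo.add_self_eq_zero, chi_zero]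
    norm_num
  · have h1 : y + 1 ≠ 0 := fun h' => h (CharTwo.add_eq_zero.1 h')
    rw [add_zero, ← chi_add_one hn]
    congr 1
    field_simp
    linear_combination (-1) * CharTwo.two_eq_zero (R := GF n)

theorem chi_add_one_div (hn : Odd n) (y : GF n) :
    chi ((y + 1) * y⁻¹) = -chi y⁻¹ + if y = 0 then 2 else 0 := by
  split_ifs with h
  · subst h
    simp [chi_zero]
    norm_num
  · rw [add_zero, ← chi_add_one hn]
    congr 1
    field_simp
    ring

theorem chi_div_mul_chi_div (y : GF n) :
    chi (y * (y + 1)⁻¹) * chi ((y + 1) * y⁻¹) = chi (y ^ 2 + y)⁻¹ := by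
  rw [← chi_add]
  congr 1
  by_cases h0 : y = 0
  · simp [h0]
  by_cases h : y = 1
  · simp [h, CharTwo.add_self_eq_zero]
  have h1 : y + 1 ≠ 0 := fun h' => h (CharTwo.add_eq_zero.1 h')
  have h2 : y ^ 2 + y ≠ 0 := by
    rw [show y ^ 2 + y = y * (y + 1) by ring]
    exact mul_ne_zero h0 h1
  field_simp
  linear_combination (y ^ 2 + y) * CharTwo.two_eq_zero (R := GF n)

theorem Acnt_eq_Acnt_one {mu : GF n} (hmu : mu ≠ 0) (i j : ZMod 2) :
    Acnt mu i j = Acnt (1 : GF n) i j := by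
  symm
  refine card_equiv (Equiv.mulLeft₀ mu hmu) fun y => ?_
  have e : mu * y + mu = mu * (y + 1) := by ring
  have h1 : mu⁻¹ * (mu * y) = y := inv_mul_cancel_left₀ hmu y
  have h2 : ∀ a b : GF n, mu * a * (mu * b)⁻¹ = a * b⁻¹ := fun a b => by
    rw [← div_eq_mul_inv, mul_div_mul_left _ _ hmu, div_eq_mul_inv]
  simp only [mem_filter_univ, Equiv.mulLeft₀_apply, inv_one, one_mul, e, h1, h2]

theorem ite_tr_eq (x : GF n) (i : ZMod 2) :
    (if tr x = i then 1 else 0 : ℚ) = (1 + (-1) ^ i.val * chi x) / 2 := by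
  unfold chi
  generalize tr x = a
  rcases zmod_two_eq_zero_or_one a with rfl | rfl <;>
    rcases zmod_two_eq_zero_or_one i with rfl | rfl <;> norm_num [ZMod.val_one]

theorem Acnt_one_eq_sum (i j : ZMod 2) :
    (Acnt (1 : GF n) i j : ℚ) = ∑ y : GF n, (1 + chi y) / 2 *
      ((1 + (-1) ^ i.val * chi (y * (y + 1)⁻¹)) / 2 *
        ((1 + (-1) ^ j.val * chi ((y + 1) * y⁻¹)) / 2)) := by
  have h0 : ∀ y : GF n, (1 + chi y) / 2 = if tr y = 0 then 1 else 0 := fun y => by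
    simp [ite_tr_eq]
  simp only [h0, ← ite_tr_eq, Acnt, inv_one, one_mul, card_filter, Nat.cast_sum, Nat.cast_ite,
    Nat.cast_one, Nat.cast_zero]
  refine sum_congr rfl fun y _ => ?_
  split_ifs <;> simp_all

theorem Acnt_one_eq (hn : Odd n) (i j : ZMod 2) :
    (Acnt (1 : GF n) i j : ℚ) =
      (2 ^ n + (-1) ^ i.val * ∑ x : GF n, chi (x⁻¹ + x) +
        (-1) ^ j.val * (4 - ∑ x : GF n, chi (x⁻¹ + x)) +
        (-1) ^ i.val * (-1) ^ j.val * ∑ x : GF n, chi (x⁻¹ + x)) / 8 := by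
  set K := ∑ x : GF n, chi (x⁻¹ + x) with hK
  have hcard : ∑ _y : GF n, (1 : ℚ) = 2 ^ n := by
    have h := GaloisField.card 2 n hn.pos.ne'
    rw [Nat.card_eq_fintype_card] at h
    simp [h]
  have hK' : ∑ y : GF n, chi y * chi y⁻¹ = K := by
    simp only [hK, chi_add, mul_comm]
  have hshift : ∑ y : GF n, chi (y + 1)⁻¹ = 0 :=
    (sum_shift fun y => chi y⁻¹).trans (sum_chi_inv hn)
  have hKshift : ∑ y : GF n, chi y * chi (y + 1)⁻¹ = -K := by
    have h := sum_shift fun y : GF n => chi y * chi y⁻¹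
    simp only [chi_add_one hn, neg_mul, sum_neg_distrib, hK'] at h
    linarith
  have hP : ∑ y : GF n, chi (y * (y + 1)⁻¹) = 2 := by
    simp [chi_div_add_one hn, sum_add_distrib, hshift]
  have hQ : ∑ y : GF n, chi ((y + 1) * y⁻¹) = 2 := by
    simp [chi_add_one_div hn, sum_add_distrib, sum_chi_inv hn]
  have hPQ : ∑ y : GF n, chi (y * (y + 1)⁻¹) * chi ((y + 1) * y⁻¹) = K := by
    simp only [chi_div_mul_chi_div, sum_sq_add hn fun z => chi z⁻¹]
    simp only [add_mul, one_mul, sum_add_distrib, sum_chi_inv hn, hK', zero_add]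
  have hχP : ∑ y : GF n, chi y * chi (y * (y + 1)⁻¹) = K - 2 := by
    simp [chi_div_add_one hn, mul_add, sum_add_distrib, hKshift, chi_one hn]
    ring
  have hχQ : ∑ y : GF n, chi y * chi ((y + 1) * y⁻¹) = 2 - K := by
    simp [chi_add_one_div hn, mul_add, sum_add_distrib, hK', chi_zero]
    ring
  have hχPQ : ∑ y : GF n, chi y * (chi (y * (y + 1)⁻¹) * chi ((y + 1) * y⁻¹)) = 0 := by
    simp only [chi_div_mul_chi_div]
    exact sum_chi_mul_sq_add hn fun z => chi z⁻¹
  rw [Acnt_one_eq_sum]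
  generalize (-1 : ℚ) ^ i.val = a
  generalize (-1 : ℚ) ^ j.val = b
  have expand : ∀ c p q : ℚ, (1 + c) / 2 * ((1 + a * p) / 2 * ((1 + b * q) / 2)) =
      (1 + c + a * p + b * q + a * b * (p * q) + a * (c * p) + b * (c * q) +
        a * b * (c * (p * q))) / 8 := fun c p q => by ring
  simp only [expand, ← sum_div, sum_add_distrib, ← mul_sum, hcard, sum_chi hn, hP, hQ, hPQ, hχP,
    hχQ, hχPQ]
  ring

end Trace

/-- the joint distribution of `(Tr(x/(x+μ)), Tr((x+μ)/x))` on the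
hyperplane `H'_μ`, expressed via the Kloosterman sum `K(1)`, for `m = 2k+1` odd. -/
theorem stmt15 (m k : ℕ) (hm : m = 2 * k + 1)
    (mu : GF m) (hmu : mu ≠ 0)
    (K1 : ℤ) (hK : K1 = ∑ x : GF m, (-1 : ℤ) ^ (tr (x⁻¹ + x)).val) :
    (Acnt mu 0 0 : ℚ) = (2:ℚ)^m / 8 + (K1 : ℚ) / 8 + 1/2 ∧
    (Acnt mu 0 1 : ℚ) = (2:ℚ)^m / 8 + (K1 : ℚ) / 8 - 1/2 ∧
    (Acnt mu 1 0 : ℚ) = (2:ℚ)^m / 8 - 3 * (K1 : ℚ) / 8 + 1/2 ∧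
    (Acnt mu 1 1 : ℚ) = (2:ℚ)^m / 8 + (K1 : ℚ) / 8 - 1/2 := by
  have hm' : Odd m := ⟨k, hm⟩
  have hK' : (K1 : ℚ) = ∑ x : GF m, chi (x⁻¹ + x) := by
    simp [hK, chi]
  simp only [Acnt_eq_Acnt_one hmu, Acnt_one_eq hm', ← hK', ZMod.val_zero, ZMod.val_one, pow_zero,
    pow_one]
  refine ⟨?_, ?_, ?_, ?_⟩ <;> ring
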